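/- Let L be a finite-dimensional simple Lie algebra over ℂ and let A be a commutative associative unital ℂ-algebra. Consider the map Lie algebra L ⊗_ℂ A with bracket [x ⊗ a, y ⊗ b] = [x, y] ⊗ ab. Then every Lie ideal of L ⊗_ℂ A (over ℂ) is of the form L ⊗ I, i.e. for every Lie ideal J of L ⊗_ℂ A there exists an ideal I of A such that J equals the span of {x ⊗ a | x ∈ L, a ∈ I}. -/

import Mathlib

open TensorProduct

/-- **Burnside's theorem** for Lie modules: the operators coming from a finite-dimensional
irreducible representation over an algebraically closed field generate all endomorphisms. -/
theorem LieModule.adjoin_range_toEnd_eq_top (K L M : Type*) [Field K] [IsAlgClosed K]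
    [LieRing L] [LieAlgebra K L] [AddCommGroup M] [Module K M] [FiniteDimensional K M]
    [LieRingModule L M] [LieModule K L M] [LieModule.IsIrreducible K L M] :
    Algebra.adjoin K (Set.range (LieModule.toEnd K L M)) = ⊤ := by
  set U := Algebra.adjoin K (Set.range (LieModule.toEnd K L M))
  have hU (x : L) : LieModule.toEnd K L M x ∈ U := Algebra.subset_adjoin ⟨x, rfl⟩
  have : Nontrivial M := (LieSubmodule.nontrivial_iff K L M).mp inferInstance
  have : IsSimpleModule U M := (isSimpleModule_iff U M).mpr
    { eq_bot_or_eq_top := fun N ↦ by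
        let N' : LieSubmodule K L M :=
          { N.restrictScalars K with
            lie_mem := fun {x m} hm ↦ N.smul_mem ⟨LieModule.toEnd K L M x, hU x⟩ hm }
        have hN (m : M) : m ∈ N' ↔ m ∈ N := Iff.rfl
        refine (IsSimpleOrder.eq_bot_or_eq_top N').imp (fun h ↦ ?_) fun h ↦ ?_ <;>
        · ext m
          simp [← hN, h] }
  refine eq_top_iff.mpr fun g _ ↦ ?_
  let f : Module.End (Module.End U M) M :=
    { g with
      map_smul' := fun φ m ↦ by
        obtain ⟨c, rfl⟩ :=
          (IsSimpleModule.algebraMap_end_bijective_of_isAlgClosed (A := U) (V := M) K).2 φ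
        exact g.map_smul c m }
  obtain ⟨s, hs⟩ := Module.Finite.fg_top (R := K) (M := M)
  obtain ⟨u, hu⟩ := jacobson_density f s
  have : g = u := LinearMap.ext_on hs fun m hm ↦ hu m hm
  exact this ▸ u.2

/-- A simple Lie algebra is perfect. -/
theorem LieAlgebra.IsSimple.span_lie_eq_top (R L : Type*) [CommRing R] [LieRing L]
    [LieAlgebra R L] [LieAlgebra.IsSimple R L] :
    Submodule.span R {⁅x, y⁆ | (x : L) (y : L)} = ⊤ := by
  rw [← LieAlgebra.coe_derivedSeries_one_eq]
  rcases LieAlgebra.IsSimple.eq_bot_or_eq_top (LieAlgebra.derivedSeries R L 1) with h | h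
  · have := (LieAlgebra.abelian_iff_derived_one_eq_bot (⊤ : LieIdeal R L)).mpr h
    exact (LieAlgebra.IsSimple.non_abelian R
      ((lie_abelian_iff_equiv_lie_abelian LieIdeal.topEquiv).mp this)).elim
  · rw [h]
    rfl

/-- If `M` is an irreducible Lie module, then a subspace of `A ⊗ M` stable under the Lie algebra
acting on the second factor is stable under every endomorphism of `M`. -/
theorem LieModule.lTensor_mem_of_isIrreducible {K L A M : Type*} [Field K] [IsAlgClosed K]
    [LieRing L] [LieAlgebra K L] [CommRing A] [Algebra K A] [AddCommGroup M] [Module K M]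
    [FiniteDimensional K M] [LieRingModule L M] [LieModule K L M]
    [LieModule.IsIrreducible K L M] {J : Submodule K (A ⊗[K] M)}
    (hJ : ∀ x : L, ∀ y ∈ J, (LieModule.toEnd K L M x).lTensor A y ∈ J)
    (f : Module.End K M) {y : A ⊗[K] M} (hy : y ∈ J) : f.lTensor A y ∈ J := by
  have hf : f ∈ Algebra.adjoin K (Set.range (LieModule.toEnd K L M)) := by
    simp [LieModule.adjoin_range_toEnd_eq_top K L M]
  induction hf using Algebra.adjoin_induction generalizing y with
  | mem _ h =>
    obtain ⟨x, rfl⟩ := h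
    exact hJ x y hy
  | algebraMap r =>
    rw [Algebra.algebraMap_eq_smul_one, Module.End.one_eq_id, LinearMap.lTensor_smul,
      LinearMap.lTensor_id]
    exact J.smul_mem r hy
  | add f g _ _ hf hg =>
    rw [LinearMap.lTensor_add]
    exact J.add_mem (hf hy) (hg hy)
  | mul f g _ _ hf hg =>
    rw [LinearMap.lTensor_mul]
    exact hf (hg hy)

/-- Every (ℂ-)Lie ideal of the map Lie algebra `A ⊗[ℂ] L` (whose bracket satisfies
`⁅a ⊗ₜ x, b ⊗ₜ y⁆ = (a * b) ⊗ₜ ⁅x, y⁆`, i.e. the map Lie algebra of a finite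
dimensional simple Lie algebra `L` with coefficients in a commutative associative
unital `ℂ`-algebra `A`) is of the form `L ⊗ I` for an ideal `I` of `A`. -/
theorem ideal_of_map_lie_algebra_eq_tensor_ideal
    (L : Type*) [LieRing L] [LieAlgebra ℂ L]
    [FiniteDimensional ℂ L] [LieAlgebra.IsSimple ℂ L]
    (A : Type*) [CommRing A] [Algebra ℂ A]
    (J : Submodule ℂ (A ⊗[ℂ] L))
    (hJ : ∀ x : A ⊗[ℂ] L, ∀ y ∈ J, ⁅x, y⁆ ∈ J) :
    ∃ I : Ideal A,
      J = Submodule.span ℂ {t : A ⊗[ℂ] L | ∃ a ∈ I, ∃ x : L, t = a ⊗ₜ[ℂ] x} := by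
  have hend (f : Module.End ℂ L) {y : A ⊗[ℂ] L} (hy : y ∈ J) : f.lTensor A y ∈ J := by
    refine LieModule.lTensor_mem_of_isIrreducible (L := L) (fun x y hy ↦ ?_) f hy
    convert hJ (1 ⊗ₜ x) y hy using 1
    clear hy
    induction y using TensorProduct.induction_on with
    | zero => simp
    | tmul a z => simp
    | add y z hy hz => simp_all
  let I : Ideal A :=
    { carrier := {a | ∀ x : L, a ⊗ₜ[ℂ] x ∈ J}
      zero_mem' := fun x ↦ by simp
      add_mem' := fun ha hb x ↦ by
        rw [TensorProduct.add_tmul]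
        exact J.add_mem (ha x) (hb x)
      smul_mem' := fun b a ha x ↦ by
        have hx : x ∈ Submodule.span ℂ {⁅x, y⁆ | (x : L) (y : L)} := by
          simp [LieAlgebra.IsSimple.span_lie_eq_top ℂ L]
        induction hx using Submodule.span_induction with
        | mem _ h =>
          obtain ⟨y, z, rfl⟩ := h
          exact hJ (b ⊗ₜ y) _ (ha z)
        | zero => simp
        | add x y _ _ hx hy =>
          rw [TensorProduct.tmul_add]
          exact J.add_mem hx hy
        | smul c x _ hx =>
          rw [TensorProduct.tmul_smul]
          exact J.smul_mem c hx }
  refine ⟨I, le_antisymm (fun y hy ↦ ?_) (Submodule.span_le.mpr ?_)⟩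
  · let e := Module.finBasis ℂ L
    obtain ⟨a, rfl⟩ := (TensorProduct.equivFinsuppOfBasisRight (M := A) e).symm.surjective y
    rw [TensorProduct.equivFinsuppOfBasisRight_symm_apply] at hy ⊢
    refine Submodule.sum_mem _ fun i _ ↦
      Submodule.subset_span ⟨a i, fun x ↦ ?_, e i, rfl⟩
    convert hend ((e.coord i).smulRight x) hy
    simp [Finsupp.sum_fintype, Finsupp.single_apply, ite_smul, TensorProduct.tmul_ite]
  · rintro _ ⟨a, ha, x, rfl⟩
    exact ha x
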